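/- Let x, y ∈ ℝ^d with max{‖x‖_∞/‖x‖₂, ‖y‖_∞/‖y‖₂} ≤ ρ for some ρ < 1, and set θ = ∠(x,y). Let Φ_x = sign(C_{r,k} D x) and Φ_y = sign(C_{r,k} D y) be the k-bit circulant binary embeddings (k ≤ d), where r ∈ ℝ^d has i.i.d. standard Gaussian entries and D is an independent diagonal matrix of i.i.d. Rademacher signs. Then Var[(1/(2k))‖Φ_x − Φ_y‖₁] ≤ (1/k)·(θ/π)·(1 − θ/π) + 32ρ, where the variance is over the choice of r and D. -/

import Mathlib

open MeasureTheory ProbabilityTheory Real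
open scoped ENNReal

noncomputable section

/-- Entrywise sign: `sgn t = 1` if `t ≥ 0`, `-1` otherwise. -/
def sgn (t : ℝ) : ℝ := if 0 ≤ t then 1 else -1

/-- Euclidean (ℓ²) norm. -/
def l2norm {ι : Type*} [Fintype ι] (x : ι → ℝ) : ℝ := Real.sqrt (∑ i, x i ^ 2)

/-- Entrywise ℓ¹ norm. -/
def l1norm {ι : Type*} [Fintype ι] (x : ι → ℝ) : ℝ := ∑ i, |x i|

/-- Supremum (ℓ∞) norm. -/
def linf {ι : Type*} [Fintype ι] (x : ι → ℝ) : ℝ := ⨆ i, |x i|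

/-- Euclidean inner product. -/
def dotp {ι : Type*} [Fintype ι] (x y : ι → ℝ) : ℝ := ∑ i, x i * y i

/-- Angle between two vectors. -/
def angle' {ι : Type*} [Fintype ι] (x y : ι → ℝ) : ℝ :=
  Real.arccos (dotp x y / (l2norm x * l2norm y))

/-- The standard Gaussian measure on `ℝ^d` (i.i.d. `N(0,1)` coordinates). -/
def gaussPi (d : ℕ) : Measure (Fin d → ℝ) := Measure.pi fun _ => gaussianReal 0 1

/-- The Rademacher measure on `ℝ`: `±1` with probability `1/2` each. -/
def radMeasure : Measure ℝ := (2 : ℝ≥0∞)⁻¹ • (Measure.dirac 1 + Measure.dirac (-1))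

instance : IsProbabilityMeasure radMeasure := by
  constructor
  simp only [radMeasure, Measure.smul_apply, Measure.coe_add, Pi.add_apply,
    Measure.dirac_apply' _ MeasurableSet.univ, Set.indicator_univ, Pi.one_apply, smul_eq_mul]
  rw [one_add_one_eq_two, ENNReal.inv_mul_cancel] <;> simp

instance (d : ℕ) : IsProbabilityMeasure (gaussPi d) := by
  unfold gaussPi; infer_instance

/-- i.i.d. Rademacher signs on `ℝ^d`. -/
def radPi (d : ℕ) : Measure (Fin d → ℝ) := Measure.pi fun _ => radMeasure

instance (d : ℕ) : IsProbabilityMeasure (radPi d) := by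
  unfold radPi; infer_instance

/-- Circular shift by `t` positions: the `j`-th entry of `shift t x` is `x ((j - t) mod d)`. -/
def shift {d : ℕ} (t : ℕ) (x : Fin d → ℝ) : Fin d → ℝ :=
  fun j => x ⟨((j : ℕ) + (d - t % d)) % d, Nat.mod_lt _ j.pos⟩

/-- The `k`-bit circulant binary embedding: `sign` of the first `k` entries of
`circ(r) · D · x`, where `D = diag D`. -/
def cbe {d k : ℕ} (hk : k ≤ d) (r D x : Fin d → ℝ) : Fin k → ℝ :=
  fun i => sgn (∑ j, r (Fin.castLE hk i - j) * (D j * x j))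

section

open scoped RealInnerProductSpace

/-- Disagreement indicator of the signs of two reals. -/
def signDiff (s t : ℝ) : ℝ := |sgn s - sgn t| / 2

lemma measurable_sgn : Measurable sgn :=
  Measurable.ite measurableSet_Ici measurable_const measurable_const

@[fun_prop]
lemma measurable_signDiff {α : Type*} [MeasurableSpace α] {f g : α → ℝ} (hf : Measurable f)
    (hg : Measurable g) : Measurable fun a => signDiff (f a) (g a) := by
  unfold signDiff
  have h₁ := measurable_sgn.comp hf
  have h₂ := measurable_sgn.comp hg
  exact ((h₁.sub h₂).abs).div_const 2

lemma signDiff_eq_ite (s t : ℝ) : signDiff s t = if (0 ≤ s ↔ 0 ≤ t) then 0 else 1 := by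
  unfold signDiff sgn
  by_cases hs : 0 ≤ s <;> by_cases ht : 0 ≤ t <;> simp [hs, ht] <;> norm_num

lemma signDiff_nonneg (s t : ℝ) : 0 ≤ signDiff s t := by
  rw [signDiff_eq_ite]; split_ifs <;> simp

lemma signDiff_le_one (s t : ℝ) : signDiff s t ≤ 1 := by
  rw [signDiff_eq_ite]; split_ifs <;> simp

lemma signDiff_mul_self (s t : ℝ) : signDiff s t * signDiff s t = signDiff s t := by
  rw [signDiff_eq_ite]; split_ifs <;> simp

lemma signDiff_self (s : ℝ) : signDiff s s = 0 := by
  simp [signDiff]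

lemma signDiff_neg_right {s : ℝ} (hs : s ≠ 0) : signDiff s (-s) = 1 := by
  rw [signDiff_eq_ite, if_neg]
  rcases hs.lt_or_gt with h | h
  · simp [h.not_ge, h.le]
  · simp [h.not_ge, h.le]

lemma signDiff_mul_pos {r : ℝ} (hr : 0 < r) (s t : ℝ) :
    signDiff (r * s) (r * t) = signDiff s t := by
  simp [signDiff_eq_ite, mul_nonneg_iff_of_pos_left hr]

/-- Replacing both arguments changes the disagreement by at most the number of sign changes. -/
lemma abs_signDiff_sub_le (s t s' t' : ℝ) :
    |signDiff s t - signDiff s' t'| ≤ signDiff s s' + signDiff t t' := by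
  simp only [signDiff_eq_ite]
  by_cases h₁ : 0 ≤ s <;> by_cases h₂ : 0 ≤ t <;> by_cases h₃ : 0 ≤ s' <;>
    by_cases h₄ : 0 ≤ t' <;> simp [h₁, h₂, h₃, h₄]

/-- A sign changes under a perturbation only if the perturbation dominates. -/
lemma signDiff_add_le (p q : ℝ) :
    signDiff (p + q) q ≤ Set.indicator (Set.Icc (-|p|) |p|) 1 q := by
  rw [signDiff_eq_ite]
  split_ifs with h
  · exact Set.indicator_nonneg (fun _ _ => zero_le_one) _
  · rw [Set.indicator_of_mem]
    · simp
    · rw [Set.mem_Icc, ← abs_le]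
      by_contra! hlt
      apply h
      rcases abs_cases p with ⟨h1, h2⟩ | ⟨h1, h2⟩ <;> rcases abs_cases q with ⟨h3, h4⟩ | ⟨h3, h4⟩ <;>
        constructor <;> intro h5 <;> linarith

section Gaussian

variable {E : Type*} [NormedAddCommGroup E] [InnerProductSpace ℝ E] [FiniteDimensional ℝ E]
  [MeasurableSpace E] [BorelSpace E]

lemma covariance_inner_stdGaussian (u v : E) :
    cov[fun z => ⟪u, z⟫, fun z => ⟪v, z⟫; stdGaussian E] = ⟪u, v⟫ := by
  rw [← covarianceBilin_apply_eq_cov IsGaussian.memLp_two_id, covarianceBilin_stdGaussian,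
    innerSL_apply_apply]

lemma map_inner_stdGaussian (u : E) :
    (stdGaussian E).map (fun z => ⟪u, z⟫) = gaussianReal 0 (‖u‖ ^ 2).toNNReal := by
  have h : HasGaussianLaw (fun z : E => ⟪u, z⟫) (stdGaussian E) :=
    ⟨by
      have := isGaussian_map (μ := stdGaussian E) (innerSL ℝ u)
      exact this⟩
  rw [h.map_eq_gaussianReal]
  congr 2
  · exact integral_strongDual_stdGaussian (innerSL ℝ u)
  · rw [← covariance_self (by fun_prop), covariance_inner_stdGaussian, real_inner_self_eq_norm_sq]

lemma indepFun_inner_stdGaussian {e f p q : E} (h₁ : ⟪e, p⟫ = 0) (h₂ : ⟪e, q⟫ = 0)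
    (h₃ : ⟪f, p⟫ = 0) (h₄ : ⟪f, q⟫ = 0) :
    IndepFun (fun z => (⟪e, z⟫, ⟪f, z⟫)) (fun z => (⟪p, z⟫, ⟪q, z⟫)) (stdGaussian E) := by
  have hG : HasGaussianLaw (fun z : E => ((fun i : Fin 2 => ⟪![e, f] i, z⟫),
      (fun j : Fin 2 => ⟪![p, q] j, z⟫))) (stdGaussian E) :=
    ⟨by
      have := isGaussian_map (μ := stdGaussian E)
        ((ContinuousLinearMap.pi fun i : Fin 2 => innerSL ℝ (![e, f] i)).prod
          (ContinuousLinearMap.pi fun i : Fin 2 => innerSL ℝ (![p, q] i)))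
      exact this⟩
  have hI := hG.indepFun_of_covariance_eval (X := fun i z => ⟪![e, f] i, z⟫)
    (Y := fun i z => ⟪![p, q] i, z⟫) (fun i j => by
      rw [covariance_inner_stdGaussian]
      fin_cases i <;> fin_cases j <;> simp [h₁, h₂, h₃, h₄])
  exact hI.comp (φ := fun w => (w 0, w 1)) (ψ := fun w => (w 0, w 1)) (by fun_prop) (by fun_prop)

lemma map_prod_inner_stdGaussian {e f : E} (he : ‖e‖ = 1) (hf : ‖f‖ = 1) (hef : ⟪e, f⟫ = 0) :
    (stdGaussian E).map (fun z => (⟪e, z⟫, ⟪f, z⟫)) =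
      (gaussianReal 0 1).prod (gaussianReal 0 1) := by
  have hI : IndepFun (fun z => ⟪e, z⟫) (fun z => ⟪f, z⟫) (stdGaussian E) := by
    have hG : HasGaussianLaw (fun z : E => (⟪e, z⟫, ⟪f, z⟫)) (stdGaussian E) :=
      ⟨by
        have := isGaussian_map (μ := stdGaussian E) ((innerSL ℝ e).prod (innerSL ℝ f))
        exact this⟩
    exact hG.indepFun_of_covariance_eq_zero (by rw [covariance_inner_stdGaussian, hef])
  rw [(indepFun_iff_map_prod_eq_prod_map_map (by fun_prop) (by fun_prop)).1 hI,
    map_inner_stdGaussian, map_inner_stdGaussian]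
  simp [he, hf]

end Gaussian

end

lemma integral_gaussianReal_prod_polar (g ψ : ℝ → ℝ) (F : ℝ × ℝ → ℝ)
    (hF : ∀ r > 0, ∀ φ ∈ Set.Ioo (-π) π, F (r * cos φ, r * sin φ) = ψ r * g φ) :
    ∫ z, F z ∂((gaussianReal 0 1).prod (gaussianReal 0 1)) =
      (∫ r in Set.Ioi 0, r * exp (-r ^ 2 / 2) * ψ r) *
        ((2 * π)⁻¹ * ∫ φ in Set.Ioo (-π) π, g φ) := by
  rw [gaussianReal_of_var_ne_zero _ one_ne_zero,
    prod_withDensity (measurable_gaussianPDF _ _) (measurable_gaussianPDF _ _),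
    integral_withDensity_eq_integral_toReal_smul (by
      have := measurable_gaussianPDF 0 1
      fun_prop) (ae_of_all _ fun z => ENNReal.mul_lt_top gaussianPDF_lt_top gaussianPDF_lt_top),
    ← Measure.volume_eq_prod, ← integral_comp_polarCoord_symm, polarCoord_target,
    Measure.volume_eq_prod, ← integral_const_mul, ← setIntegral_prod_mul]
  refine setIntegral_congr_fun (measurableSet_Ioi.prod measurableSet_Ioo) fun p hp => ?_
  have hp1 : 0 < p.1 := hp.1
  simp only [polarCoord_symm_apply, ENNReal.toReal_mul, toReal_gaussianPDF, gaussianPDFReal,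
    smul_eq_mul, hF p.1 hp1 p.2 hp.2, NNReal.coe_one, mul_one, sub_zero]
  have h2 : exp (-p.1 ^ 2 / 2) =
      exp (-(p.1 * cos p.2) ^ 2 / 2) * exp (-(p.1 * sin p.2) ^ 2 / 2) := by
    rw [← exp_add]
    congr 1
    linear_combination (p.1 ^ 2 / 2) * (sin_sq_add_cos_sq p.2)
  have h3 : (√(2 * π))⁻¹ * (√(2 * π))⁻¹ = (2 * π)⁻¹ := by
    rw [← mul_inv, mul_self_sqrt (by positivity)]
  rw [h2, ← h3]
  ring

lemma integral_radial_gaussian :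
    ∫ r in Set.Ioi (0 : ℝ), r * exp (-r ^ 2 / 2) * 1 = 1 := by
  have h := integral_gaussianReal_prod_polar 1 1 1 (by simp)
  have h1 : ((2 * π)⁻¹ * ∫ φ in Set.Ioo (-π) π, (1 : ℝ → ℝ) φ) = 1 := by
    simp [Real.volume_real_Ioo_of_le (by linarith [pi_pos] : -π ≤ π)]
    field_simp
    ring
  rw [h1] at h
  simpa using h.symm

/-- Sign disagreement of two unit directions at angle `2α`, in coordinates adapted to their
bisector. -/
def planeDiff (α : ℝ) (z : ℝ × ℝ) : ℝ :=
  signDiff (cos α * z.1 + sin α * z.2) (cos α * z.1 - sin α * z.2)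

/-- Radius of a point of the plane. -/
def planeRadius (z : ℝ × ℝ) : ℝ := √(z.1 ^ 2 + z.2 ^ 2)

@[fun_prop]
lemma measurable_planeDiff (α : ℝ) : Measurable (planeDiff α) := by
  unfold planeDiff; fun_prop

@[fun_prop]
lemma measurable_planeRadius : Measurable planeRadius := by
  unfold planeRadius; fun_prop

lemma planeRadius_nonneg (z : ℝ × ℝ) : 0 ≤ planeRadius z := sqrt_nonneg _

lemma abs_linear_le_planeRadius (a b : ℝ) (z : ℝ × ℝ) :
    |a * z.1 + b * z.2| ≤ (|a| + |b|) * planeRadius z := by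
  have h1 : |z.1| ≤ planeRadius z := abs_le_sqrt (by nlinarith [sq_nonneg z.2])
  have h2 : |z.2| ≤ planeRadius z := abs_le_sqrt (by nlinarith [sq_nonneg z.1])
  calc |a * z.1 + b * z.2| ≤ |a| * |z.1| + |b| * |z.2| := by
        rw [← abs_mul, ← abs_mul]; exact abs_add_le _ _
    _ ≤ |a| * planeRadius z + |b| * planeRadius z := by gcongr
    _ = _ := by ring

lemma planeRadius_polar {r : ℝ} (hr : 0 < r) (φ : ℝ) :
    planeRadius (r * cos φ, r * sin φ) = r := by
  rw [planeRadius, show (r * cos φ) ^ 2 + (r * sin φ) ^ 2 = r ^ 2 by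
    linear_combination r ^ 2 * sin_sq_add_cos_sq φ, sqrt_sq hr.le]

lemma planeDiff_polar (α : ℝ) {r : ℝ} (hr : 0 < r) (φ : ℝ) :
    planeDiff α (r * cos φ, r * sin φ) = signDiff (cos (φ - α)) (cos (φ + α)) := by
  rw [← signDiff_mul_pos hr, planeDiff, cos_sub, cos_add]
  congr 1 <;> ring

lemma cos_nonneg_iff_le {x : ℝ} (h1 : -(π / 2) ≤ x) (h2 : x < 3 * (π / 2)) :
    0 ≤ cos x ↔ x ≤ π / 2 := by
  constructor
  · intro h
    by_contra! hlt
    have := cos_neg_of_pi_div_two_lt_of_lt hlt (by linarith)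
    linarith
  · intro h
    exact cos_nonneg_of_mem_Icc ⟨h1, h⟩

lemma signDiff_cos_eq_indicator {α φ : ℝ} (hα₀ : 0 ≤ α) (hα : α ≤ π / 2)
    (hφ : φ ∈ Set.Ioo (-π) π) :
    signDiff (cos (φ - α)) (cos (φ + α)) =
      Set.indicator (Set.Ioc (π / 2 - α) (π / 2 + α)) 1 φ +
        Set.indicator (Set.Ico (-(π / 2 + α)) (-(π / 2 - α))) 1 φ := by
  obtain ⟨h1, h2⟩ := hφ
  have hπ := pi_pos
  rw [signDiff_eq_ite]
  simp only [Set.indicator_apply, Set.mem_Ioc, Set.mem_Ico, Pi.one_apply]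
  rcases le_or_gt 0 φ with h0 | h0
  · simp only [cos_nonneg_iff_le (by linarith : -(π / 2) ≤ φ - α) (by linarith),
      cos_nonneg_iff_le (by linarith : -(π / 2) ≤ φ + α) (by linarith)]
    by_cases c1 : φ - α ≤ π / 2 <;> by_cases c2 : φ + α ≤ π / 2
    · rw [if_pos (by tauto), if_neg (by intro h; linarith [h.1]),
        if_neg (by intro h; linarith [h.2])]; simp
    · rw [if_neg (by tauto), if_pos (by constructor <;> linarith),
        if_neg (by intro h; linarith [h.2])]; simp
    · linarith
    · rw [if_pos (by tauto), if_neg (by intro h; linarith [h.2]),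
        if_neg (by intro h; linarith [h.2])]; simp
  · simp only [← cos_neg (φ - α), ← cos_neg (φ + α)]
    simp only [cos_nonneg_iff_le (by linarith : -(π / 2) ≤ -(φ - α)) (by linarith),
      cos_nonneg_iff_le (by linarith : -(π / 2) ≤ -(φ + α)) (by linarith)]
    by_cases c1 : -(φ - α) ≤ π / 2 <;> by_cases c2 : -(φ + α) ≤ π / 2
    · rw [if_pos (by tauto), if_neg (by intro h; linarith [h.1]),
        if_neg (by intro h; linarith [h.2])]; simp
    · linarith
    · rw [if_neg (by tauto), if_neg (by intro h; linarith [h.1]),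
        if_pos (by constructor <;> linarith)]; simp
    · rw [if_pos (by tauto), if_neg (by intro h; linarith [h.1]),
        if_neg (by intro h; linarith [h.1])]; simp

lemma integral_signDiff_cos {α : ℝ} (hα₀ : 0 ≤ α) (hα : α ≤ π / 2) :
    ∫ φ in Set.Ioo (-π) π, signDiff (cos (φ - α)) (cos (φ + α)) = 4 * α := by
  have hs₁ : Set.Ioc (π / 2 - α) (π / 2 + α) ⊆ Set.Icc (-π) π :=
    fun φ h => ⟨by linarith [h.1, pi_pos], by linarith [h.2]⟩
  have hs₂ : Set.Ico (-(π / 2 + α)) (-(π / 2 - α)) ⊆ Set.Icc (-π) π :=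
    fun φ h => ⟨by linarith [h.1], by linarith [h.2, pi_pos]⟩
  rw [setIntegral_congr_fun measurableSet_Ioo
      (fun φ hφ => signDiff_cos_eq_indicator hα₀ hα hφ), integral_add
      ((integrable_const 1).indicator measurableSet_Ioc)
      ((integrable_const 1).indicator measurableSet_Ico),
    integral_indicator_one measurableSet_Ioc, integral_indicator_one measurableSet_Ico,
    Measure.restrict_congr_set Ioo_ae_eq_Icc,
    measureReal_restrict_apply measurableSet_Ioc, measureReal_restrict_apply measurableSet_Ico,
    Set.inter_eq_left.2 hs₁, Set.inter_eq_left.2 hs₂,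
    Real.volume_real_Ioc_of_le (by linarith), Real.volume_real_Ico_of_le (by linarith)]
  ring

lemma integral_planeDiff {α : ℝ} (hα₀ : 0 ≤ α) (hα : α ≤ π / 2) :
    ∫ z, planeDiff α z ∂((gaussianReal 0 1).prod (gaussianReal 0 1)) = 2 * α / π := by
  rw [integral_gaussianReal_prod_polar (fun φ => signDiff (cos (φ - α)) (cos (φ + α))) 1
    (planeDiff α) (fun r hr φ _ => by simp [planeDiff_polar α hr])]
  simp only [Pi.one_apply]
  rw [integral_radial_gaussian, integral_signDiff_cos hα₀ hα]
  field_simp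
  ring

lemma integral_planeDiff_mul_planeRadius (α : ℝ) :
    ∫ z, planeDiff α z * planeRadius z ∂((gaussianReal 0 1).prod (gaussianReal 0 1)) =
      (∫ z, planeDiff α z ∂((gaussianReal 0 1).prod (gaussianReal 0 1))) *
      ∫ z, planeRadius z ∂((gaussianReal 0 1).prod (gaussianReal 0 1)) := by
  have h1 : ((2 * π)⁻¹ * ∫ φ in Set.Ioo (-π) π, (1 : ℝ → ℝ) φ) = 1 := by
    simp [Real.volume_real_Ioo_of_le (by linarith [pi_pos] : -π ≤ π)]
    field_simp
    ring
  rw [integral_gaussianReal_prod_polar (fun φ => signDiff (cos (φ - α)) (cos (φ + α))) 1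
    (planeDiff α) (fun r hr φ _ => by simp [planeDiff_polar α hr]),
    integral_gaussianReal_prod_polar (fun φ => signDiff (cos (φ - α)) (cos (φ + α))) (fun r => r)
      (fun z => planeDiff α z * planeRadius z)
      (fun r hr φ _ => by rw [planeDiff_polar α hr, planeRadius_polar hr, mul_comm]),
    integral_gaussianReal_prod_polar 1 (fun r => r) planeRadius
      (fun r hr φ _ => by simp [planeRadius_polar hr]), h1]
  simp only [Pi.one_apply]
  rw [integral_radial_gaussian]
  ring

lemma integrable_sq_gaussianReal : Integrable (fun x : ℝ => x ^ 2) (gaussianReal 0 1) :=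
  (memLp_id_gaussianReal' 2 (by simp)).integrable_sq

lemma integral_sq_gaussianReal : ∫ x : ℝ, x ^ 2 ∂(gaussianReal 0 1) = 1 := by
  have h := variance_fun_id_gaussianReal (μ := 0) (v := 1)
  rw [variance_eq_integral (by fun_prop)] at h
  simpa using h

lemma integrable_sq_add_sq :
    Integrable (fun z : ℝ × ℝ => z.1 ^ 2 + z.2 ^ 2)
      ((gaussianReal 0 1).prod (gaussianReal 0 1)) :=
  (integrable_sq_gaussianReal.comp_fst _).add (integrable_sq_gaussianReal.comp_snd _)

lemma planeRadius_le (z : ℝ × ℝ) :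
    planeRadius z ≤ (z.1 ^ 2 + z.2 ^ 2) * (√2 / 4) + √2 / 2 := by
  have h2 : √2 ^ 2 = 2 := sq_sqrt (by norm_num)
  have h : planeRadius z ^ 2 = z.1 ^ 2 + z.2 ^ 2 := sq_sqrt (by positivity)
  rw [← h]
  have h3 : 0 ≤ √2 / 4 * (planeRadius z - √2) ^ 2 := by positivity
  linear_combination h3 - (planeRadius z / 2 - √2 / 4) * h2

lemma integrable_planeRadius :
    Integrable planeRadius ((gaussianReal 0 1).prod (gaussianReal 0 1)) := by
  refine ((integrable_sq_add_sq.mul_const (√2 / 4)).add (integrable_const (√2 / 2))).mono'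
    (by fun_prop) (ae_of_all _ fun z => ?_)
  rw [Real.norm_of_nonneg (planeRadius_nonneg z)]
  exact planeRadius_le z

lemma integral_planeRadius_le :
    ∫ z, planeRadius z ∂((gaussianReal 0 1).prod (gaussianReal 0 1)) ≤ √2 := by
  refine (integral_mono integrable_planeRadius ((integrable_sq_add_sq.mul_const (√2 / 4)).add
    (integrable_const (√2 / 2))) planeRadius_le).trans ?_
  simp only [Pi.add_apply]
  rw [integral_add (integrable_sq_add_sq.mul_const _) (integrable_const _), integral_mul_const,
    integral_add (integrable_sq_gaussianReal.comp_fst _) (integrable_sq_gaussianReal.comp_snd _),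
    integral_fun_fst (fun x : ℝ => x ^ 2), integral_fun_snd (fun x : ℝ => x ^ 2),
    integral_sq_gaussianReal]
  simp
  linarith

lemma gaussianReal_real_Icc_le {v : NNReal} (hv : 1 / 2 ≤ (v : ℝ)) {t : ℝ} (ht : 0 ≤ t) :
    (gaussianReal 0 v).real (Set.Icc (-t) t) ≤ 2 * t / √π := by
  have hv0 : v ≠ 0 := by rintro rfl; norm_num at hv
  have hpdf : ∀ x, gaussianPDFReal 0 v x ≤ 1 / √π := fun x => by
    rw [gaussianPDFReal, ← mul_one (1 / √π), one_div]
    gcongr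
    · nlinarith [pi_pos]
    · rw [exp_le_one_iff]
      exact div_nonpos_of_nonpos_of_nonneg (by nlinarith [sq_nonneg (x - 0)]) (by positivity)
  rw [measureReal_def, gaussianReal_apply_eq_integral _ hv0, ENNReal.toReal_ofReal
    (integral_nonneg fun x => gaussianPDFReal_nonneg _ _ _)]
  calc ∫ x in Set.Icc (-t) t, gaussianPDFReal 0 v x
      ≤ ∫ x in Set.Icc (-t) t, 1 / √π :=
        integral_mono (integrable_gaussianPDFReal _ _).restrict (integrable_const _) hpdf
    _ = 2 * t / √π := by
        rw [setIntegral_const, Real.volume_real_Icc_of_le (by linarith), smul_eq_mul]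
        ring

section

open scoped RealInnerProductSpace

lemma integrable_of_mem_Icc {α : Type*} [MeasurableSpace α] {μ : Measure α} [IsFiniteMeasure μ]
    {g : α → ℝ} (hg : Measurable g) (h₀ : ∀ a, 0 ≤ g a) (h₁ : ∀ a, g a ≤ 1) : Integrable g μ :=
  Integrable.of_bound hg.aestronglyMeasurable 1
    (ae_of_all _ fun a => by rw [Real.norm_of_nonneg (h₀ a)]; exact h₁ a)

section

variable {E : Type*} [NormedAddCommGroup E] [InnerProductSpace ℝ E]

lemma norm_sq_sub_projections {e f w : E} (he : ‖e‖ = 1) (hf : ‖f‖ = 1) (hef : ⟪e, f⟫ = 0)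
    (hw : ‖w‖ = 1) :
    ‖w - ⟪e, w⟫ • e - ⟪f, w⟫ • f‖ ^ 2 = 1 - ⟪e, w⟫ ^ 2 - ⟪f, w⟫ ^ 2 := by
  have he' : ⟪e, e⟫ = 1 := by rw [real_inner_self_eq_norm_sq, he, one_pow]
  have hf' : ⟪f, f⟫ = 1 := by rw [real_inner_self_eq_norm_sq, hf, one_pow]
  have hw' : ⟪w, w⟫ = 1 := by rw [real_inner_self_eq_norm_sq, hw, one_pow]
  rw [← real_inner_self_eq_norm_sq]
  simp only [inner_sub_left, inner_sub_right, inner_smul_left, inner_smul_right, he', hf', hw',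
    hef, real_inner_comm e f, real_inner_comm e w, real_inner_comm f w, RCLike.conj_to_real]
  simp only [real_inner_comm w e, real_inner_comm w f]
  ring

lemma inner_sub_projections_left {e f : E} (he : ‖e‖ = 1) (hef : ⟪e, f⟫ = 0) (w : E) :
    ⟪e, w - ⟪e, w⟫ • e - ⟪f, w⟫ • f⟫ = 0 := by
  simp [inner_sub_right, inner_smul_right, hef, he]

lemma inner_sub_projections_right {e f : E} (hf : ‖f‖ = 1) (hef : ⟪e, f⟫ = 0) (w : E) :
    ⟪f, w - ⟪e, w⟫ • e - ⟪f, w⟫ • f⟫ = 0 := by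
  simp [inner_sub_right, inner_smul_right, real_inner_comm, hef, hf]

lemma exists_bisector_basis {α : ℝ} (hα₀ : 0 < α) (hα : α < π / 2) {u v : E} (hu : ‖u‖ = 1)
    (hv : ‖v‖ = 1) (huv : ⟪u, v⟫ = cos (2 * α)) :
    ∃ e f : E, ‖e‖ = 1 ∧ ‖f‖ = 1 ∧ ⟪e, f⟫ = 0 ∧
      (∀ z, ⟪u, z⟫ = cos α * ⟪e, z⟫ + sin α * ⟪f, z⟫) ∧
      (∀ z, ⟪v, z⟫ = cos α * ⟪e, z⟫ - sin α * ⟪f, z⟫) := by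
  have hs : 0 < sin α := sin_pos_of_pos_of_lt_pi hα₀ (by linarith)
  have hc : 0 < cos α := cos_pos_of_mem_Ioo ⟨by linarith, hα⟩
  have hu' : ⟪u, u⟫ = 1 := by rw [real_inner_self_eq_norm_sq, hu, one_pow]
  have hv' : ⟪v, v⟫ = 1 := by rw [real_inner_self_eq_norm_sq, hv, one_pow]
  have hvu : ⟪v, u⟫ = cos (2 * α) := by rw [real_inner_comm, huv]
  refine ⟨(2 * cos α)⁻¹ • (u + v), (2 * sin α)⁻¹ • (u - v), ?_, ?_, ?_, ?_, ?_⟩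
  · rw [← sq_eq_sq₀ (norm_nonneg _) zero_le_one, ← real_inner_self_eq_norm_sq]
    simp only [inner_add_left, inner_add_right, inner_smul_left, inner_smul_right,
      RCLike.conj_to_real, hu', hv', huv, hvu]
    rw [cos_two_mul]
    field_simp
    ring
  · rw [← sq_eq_sq₀ (norm_nonneg _) zero_le_one, ← real_inner_self_eq_norm_sq]
    simp only [inner_sub_left, inner_sub_right, inner_smul_left, inner_smul_right,
      RCLike.conj_to_real, hu', hv', huv, hvu]
    rw [cos_two_mul, cos_sq']
    field_simp
    ring
  · simp only [inner_add_left, inner_sub_right, inner_smul_left, inner_smul_right,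
      RCLike.conj_to_real, hu', hv', huv, hvu]
    ring
  · intro z
    simp only [inner_add_left, inner_sub_left, inner_smul_left, RCLike.conj_to_real]
    field_simp
    ring
  · intro z
    simp only [inner_add_left, inner_sub_left, inner_smul_left, RCLike.conj_to_real]
    field_simp
    ring

variable [FiniteDimensional ℝ E] [MeasurableSpace E] [BorelSpace E]

lemma integral_comp_inner_pair {e f : E} (he : ‖e‖ = 1) (hf : ‖f‖ = 1) (hef : ⟪e, f⟫ = 0)
    {h : ℝ × ℝ → ℝ} (hm : Measurable h) :
    ∫ z, h (⟪e, z⟫, ⟪f, z⟫) ∂(stdGaussian E) =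
      ∫ x, h x ∂((gaussianReal 0 1).prod (gaussianReal 0 1)) := by
  rw [← map_prod_inner_stdGaussian he hf hef, integral_map (by fun_prop)
    hm.aestronglyMeasurable]

/-- Removing from `w` its component in the plane of `e, f` rarely changes the sign of the
projection onto `w`, even on an event that depends only on that plane. -/
lemma integral_mul_signDiff_sub_projections_le {e f w : E} (he : ‖e‖ = 1) (hf : ‖f‖ = 1)
    (hef : ⟪e, f⟫ = 0) (hw : ‖w‖ = 1) {h : ℝ × ℝ → ℝ} (hm : Measurable h) (h₀ : ∀ x, 0 ≤ h x)
    (h₁ : ∀ x, h x ≤ 1)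
    (hR : ∫ x, h x * planeRadius x ∂((gaussianReal 0 1).prod (gaussianReal 0 1)) ≤
      √2 * ∫ x, h x ∂((gaussianReal 0 1).prod (gaussianReal 0 1))) :
    ∫ z, h (⟪e, z⟫, ⟪f, z⟫) *
        signDiff ⟪w, z⟫ ⟪w - ⟪e, w⟫ • e - ⟪f, w⟫ • f, z⟫ ∂(stdGaussian E) ≤
      2 * (|⟪e, w⟫| + |⟪f, w⟫|) *
        ∫ x, h x ∂((gaussianReal 0 1).prod (gaussianReal 0 1)) := by
  have hsq := norm_sq_sub_projections he hf hef hw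
  have hq₁ := inner_sub_projections_left he hef w
  have hq₂ := inner_sub_projections_right hf hef w
  have hwq : ∀ z, ⟪w, z⟫ = (⟪e, w⟫ * ⟪e, z⟫ + ⟪f, w⟫ * ⟪f, z⟫) +
      ⟪w - ⟪e, w⟫ • e - ⟪f, w⟫ • f, z⟫ := fun z => by
    simp only [inner_sub_left, inner_smul_left, RCLike.conj_to_real]
    ring
  simp_rw [hwq]
  generalize w - ⟪e, w⟫ • e - ⟪f, w⟫ • f = q at *
  set a := ⟪e, w⟫
  set b := ⟪f, w⟫
  set γ := (gaussianReal 0 1).prod (gaussianReal 0 1)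
  have hm0 : 0 ≤ ∫ x, h x ∂γ := integral_nonneg h₀
  rcases lt_or_ge (‖q‖ ^ 2) (1 / 2) with hlt | hge
  · have hab : 1 ≤ 2 * (|a| + |b|) := by
      nlinarith [abs_nonneg a, abs_nonneg b, sq_abs a, sq_abs b,
        mul_nonneg (abs_nonneg a) (abs_nonneg b)]
    calc _ ≤ ∫ z, h (⟪e, z⟫, ⟪f, z⟫) ∂(stdGaussian E) := by
          refine integral_mono (integrable_of_mem_Icc (by fun_prop)
            (fun z => mul_nonneg (h₀ _) (signDiff_nonneg _ _))
            fun z => mul_le_one₀ (h₁ _) (signDiff_nonneg _ _) (signDiff_le_one _ _))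
            (integrable_of_mem_Icc (by fun_prop) (fun z => h₀ _) (fun z => h₁ _))
            fun z => mul_le_of_le_one_right (h₀ _) (signDiff_le_one _ _)
      _ = ∫ x, h x ∂γ := integral_comp_inner_pair he hf hef hm
      _ ≤ _ := le_mul_of_one_le_left hm0 hab
  · have hI : IndepFun (fun z => (⟪e, z⟫, ⟪f, z⟫)) (fun z => ⟪q, z⟫) (stdGaussian E) :=
      (indepFun_inner_stdGaussian hq₁ hq₁ hq₂ hq₂).comp measurable_id measurable_fst
    have hlaw : (stdGaussian E).map (fun z => ((⟪e, z⟫, ⟪f, z⟫), ⟪q, z⟫)) =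
        γ.prod (gaussianReal 0 (‖q‖ ^ 2).toNNReal) := by
      rw [(indepFun_iff_map_prod_eq_prod_map_map (by fun_prop) (by fun_prop)).1 hI,
        map_prod_inner_stdGaussian he hf hef, map_inner_stdGaussian]
    set ν := gaussianReal 0 (‖q‖ ^ 2).toNNReal
    let G : (ℝ × ℝ) × ℝ → ℝ := fun y =>
      h y.1 * signDiff ((a * y.1.1 + b * y.1.2) + y.2) y.2
    have hGm : Measurable G := by fun_prop
    have hGi : Integrable G (γ.prod ν) := integrable_of_mem_Icc hGm
      (fun z => mul_nonneg (h₀ _) (signDiff_nonneg _ _))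
      fun z => mul_le_one₀ (h₁ _) (signDiff_nonneg _ _) (signDiff_le_one _ _)
    have hin : ∀ x, ∫ t, G (x, t) ∂ν ≤ 2 / √π * (|a| + |b|) * (h x * planeRadius x) := fun x => by
      simp only [G]
      rw [integral_const_mul]
      have h3 : ∫ t, signDiff ((a * x.1 + b * x.2) + t) t ∂ν ≤
          2 * |a * x.1 + b * x.2| / √π := by
        refine (integral_mono (integrable_of_mem_Icc (by fun_prop) (fun _ => signDiff_nonneg _ _)
          fun _ => signDiff_le_one _ _) ((integrable_const 1).indicator measurableSet_Icc)
          fun t => signDiff_add_le _ t).trans ?_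
        rw [integral_indicator_one measurableSet_Icc]
        exact gaussianReal_real_Icc_le (by rw [Real.coe_toNNReal _ (sq_nonneg _)]; exact hge)
          (abs_nonneg _)
      calc _ ≤ h x * (2 * ((|a| + |b|) * planeRadius x) / √π) := by
            refine mul_le_mul_of_nonneg_left (h3.trans ?_) (h₀ x)
            gcongr
            exact abs_linear_le_planeRadius a b x
        _ = _ := by ring
    have hhR : Integrable (fun x => h x * planeRadius x) γ :=
      integrable_planeRadius.mono' (by fun_prop) (ae_of_all _ fun x => by
        rw [Real.norm_of_nonneg (mul_nonneg (h₀ x) (planeRadius_nonneg x))]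
        exact mul_le_of_le_one_left (planeRadius_nonneg x) (h₁ x))
    calc _ = ∫ y, G y ∂(γ.prod ν) := by
          rw [← hlaw, integral_map (by fun_prop) hGm.aestronglyMeasurable]
      _ = ∫ x, ∫ t, G (x, t) ∂ν ∂γ := integral_prod _ hGi
      _ ≤ ∫ x, 2 / √π * (|a| + |b|) * (h x * planeRadius x) ∂γ :=
          integral_mono hGi.integral_prod_left (hhR.const_mul _) hin
      _ ≤ 2 / √π * (|a| + |b|) * (√2 * ∫ x, h x ∂γ) := by
          rw [integral_const_mul]; gcongr
      _ = (√2 / √π) * (2 * (|a| + |b|) * ∫ x, h x ∂γ) := by ring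
      _ ≤ 1 * (2 * (|a| + |b|) * ∫ x, h x ∂γ) := by
          gcongr
          rw [div_le_one (by positivity)]
          exact sqrt_le_sqrt (by linarith [pi_gt_three])
      _ = _ := one_mul _

/-- Approximate decorrelation of an event of the plane of `e, f` from the sign disagreement of two
directions that are nearly orthogonal to that plane. -/
lemma abs_integral_mul_signDiff_sub_le {e f w w' : E} (he : ‖e‖ = 1) (hf : ‖f‖ = 1)
    (hef : ⟪e, f⟫ = 0) (hw : ‖w‖ = 1) (hw' : ‖w'‖ = 1) {h : ℝ × ℝ → ℝ} (hm : Measurable h)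
    (h₀ : ∀ x, 0 ≤ h x) (h₁ : ∀ x, h x ≤ 1)
    (hR : ∫ x, h x * planeRadius x ∂((gaussianReal 0 1).prod (gaussianReal 0 1)) ≤
      √2 * ∫ x, h x ∂((gaussianReal 0 1).prod (gaussianReal 0 1))) :
    |∫ z, h (⟪e, z⟫, ⟪f, z⟫) * signDiff ⟪w, z⟫ ⟪w', z⟫ ∂(stdGaussian E) -
        (∫ x, h x ∂((gaussianReal 0 1).prod (gaussianReal 0 1))) *
          ∫ z, signDiff ⟪w, z⟫ ⟪w', z⟫ ∂(stdGaussian E)| ≤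
      4 * ((|⟪e, w⟫| + |⟪f, w⟫|) + (|⟪e, w'⟫| + |⟪f, w'⟫|)) *
        ∫ x, h x ∂((gaussianReal 0 1).prod (gaussianReal 0 1)) := by
  have hone : ∫ x, (1 : ℝ × ℝ → ℝ) x * planeRadius x
      ∂((gaussianReal 0 1).prod (gaussianReal 0 1)) ≤
      √2 * ∫ x, (1 : ℝ × ℝ → ℝ) x ∂((gaussianReal 0 1).prod (gaussianReal 0 1)) := by
    simpa using integral_planeRadius_le
  have A := integral_mul_signDiff_sub_projections_le he hf hef hw hm h₀ h₁ hR
  have A' := integral_mul_signDiff_sub_projections_le he hf hef hw' hm h₀ h₁ hR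
  have B := integral_mul_signDiff_sub_projections_le he hf hef hw (h := 1) measurable_one
    (by simp) (by simp) hone
  have B' := integral_mul_signDiff_sub_projections_le he hf hef hw' (h := 1) measurable_one
    (by simp) (by simp) hone
  have hI := indepFun_inner_stdGaussian (inner_sub_projections_left he hef w)
    (inner_sub_projections_left he hef w') (inner_sub_projections_right hf hef w)
    (inner_sub_projections_right hf hef w')
  generalize w - ⟪e, w⟫ • e - ⟪f, w⟫ • f = q at *
  generalize w' - ⟪e, w'⟫ • e - ⟪f, w'⟫ • f = q' at *
  set γ := (gaussianReal 0 1).prod (gaussianReal 0 1)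
  have hm0 : 0 ≤ ∫ x, h x ∂γ := integral_nonneg h₀
  simp only [Pi.one_apply, one_mul, integral_const, probReal_univ, smul_eq_mul, mul_one] at B B'
  have hind : ∫ z, h (⟪e, z⟫, ⟪f, z⟫) * signDiff ⟪q, z⟫ ⟪q', z⟫ ∂(stdGaussian E) =
      (∫ x, h x ∂γ) * ∫ z, signDiff ⟪q, z⟫ ⟪q', z⟫ ∂(stdGaussian E) := by
    rw [← integral_comp_inner_pair he hf hef hm]
    exact (hI.comp (φ := h) (ψ := fun x => signDiff x.1 x.2) hm
      (by fun_prop)).integral_fun_mul_eq_mul_integral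
        (Measurable.aestronglyMeasurable (by fun_prop))
        (Measurable.aestronglyMeasurable (by fun_prop))
  have ih : ∀ u v : E, Integrable (fun z => h (⟪e, z⟫, ⟪f, z⟫) * signDiff ⟪u, z⟫ ⟪v, z⟫)
      (stdGaussian E) := fun u v => integrable_of_mem_Icc (by fun_prop)
      (fun z => mul_nonneg (h₀ _) (signDiff_nonneg _ _))
      fun z => mul_le_one₀ (h₁ _) (signDiff_nonneg _ _) (signDiff_le_one _ _)
  have is : ∀ u v : E, Integrable (fun z => signDiff ⟪u, z⟫ ⟪v, z⟫) (stdGaussian E) :=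
    fun u v => integrable_of_mem_Icc (by fun_prop) (fun z => signDiff_nonneg _ _)
      fun z => signDiff_le_one _ _
  have T₁ : |∫ z, h (⟪e, z⟫, ⟪f, z⟫) * signDiff ⟪w, z⟫ ⟪w', z⟫ ∂(stdGaussian E) -
      ∫ z, h (⟪e, z⟫, ⟪f, z⟫) * signDiff ⟪q, z⟫ ⟪q', z⟫ ∂(stdGaussian E)| ≤
      ∫ z, h (⟪e, z⟫, ⟪f, z⟫) * signDiff ⟪w, z⟫ ⟪q, z⟫ ∂(stdGaussian E) +
      ∫ z, h (⟪e, z⟫, ⟪f, z⟫) * signDiff ⟪w', z⟫ ⟪q', z⟫ ∂(stdGaussian E) := by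
    rw [← integral_sub (ih _ _) (ih _ _), ← integral_add (ih _ _) (ih _ _)]
    refine (abs_integral_le_integral_abs).trans (integral_mono ((ih _ _).sub (ih _ _)).abs
      ((ih _ _).add (ih _ _)) fun z => ?_)
    simp only
    rw [← mul_sub, abs_mul, abs_of_nonneg (h₀ _), ← mul_add]
    exact mul_le_mul_of_nonneg_left (abs_signDiff_sub_le _ _ _ _) (h₀ _)
  have T₂ : |∫ z, signDiff ⟪w, z⟫ ⟪w', z⟫ ∂(stdGaussian E) -
      ∫ z, signDiff ⟪q, z⟫ ⟪q', z⟫ ∂(stdGaussian E)| ≤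
      ∫ z, signDiff ⟪w, z⟫ ⟪q, z⟫ ∂(stdGaussian E) +
      ∫ z, signDiff ⟪w', z⟫ ⟪q', z⟫ ∂(stdGaussian E) := by
    rw [← integral_sub (is _ _) (is _ _), ← integral_add (is _ _) (is _ _)]
    exact (abs_integral_le_integral_abs).trans (integral_mono ((is _ _).sub (is _ _)).abs
      ((is _ _).add (is _ _)) fun z => abs_signDiff_sub_le _ _ _ _)
  rw [hind] at T₁
  have T₃ := mul_le_mul_of_nonneg_left (T₂.trans (add_le_add B B')) hm0
  have T₄ := T₁.trans (add_le_add A A')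
  rw [← abs_of_nonneg hm0, ← abs_mul, abs_of_nonneg hm0] at T₃
  rw [abs_le] at T₃ T₄ ⊢
  constructor <;> linarith [T₃.1, T₃.2, T₄.1, T₄.2]

lemma ae_inner_ne_zero {u : E} (hu : ‖u‖ = 1) : ∀ᵐ z ∂(stdGaussian E), ⟪u, z⟫ ≠ 0 := by
  have : NullSingletonClass (gaussianReal 0 1) := nullSingletonClass_gaussianReal one_ne_zero
  have h := map_inner_stdGaussian u
  rw [hu, one_pow, Real.toNNReal_one] at h
  have h2 : ∀ᵐ t ∂(gaussianReal 0 1), t ≠ 0 := by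
    rw [ae_iff]; simp
  rw [← h] at h2
  exact ae_of_ae_map (f := fun z => ⟪u, z⟫) (p := fun t => t ≠ 0) (by fun_prop) h2

/-- The probability that a random hyperplane separates two unit vectors at angle `θ`. -/
lemma integral_signDiff_inner {u v : E} (hu : ‖u‖ = 1) (hv : ‖v‖ = 1) {θ : ℝ} (h₀ : 0 ≤ θ)
    (hπ : θ ≤ π) (huv : ⟪u, v⟫ = cos θ) :
    ∫ z, signDiff ⟪u, z⟫ ⟪v, z⟫ ∂(stdGaussian E) = θ / π := by
  rcases h₀.eq_or_lt with rfl | h₀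
  · obtain rfl := (inner_eq_one_iff_of_norm_eq_one hu hv).1 (huv.trans cos_zero)
    simp [signDiff_self]
  rcases hπ.eq_or_lt with rfl | hπ
  · have hneg : -u = v := by
      refine (inner_eq_one_iff_of_norm_eq_one (𝕜 := ℝ) (by rwa [norm_neg]) hv).1 ?_
      rw [inner_neg_left, huv, cos_pi, neg_neg]
    have : (fun z => signDiff ⟪u, z⟫ ⟪v, z⟫) =ᵐ[stdGaussian E] fun _ => 1 := by
      filter_upwards [ae_inner_ne_zero hu] with z hz
      rw [← hneg, inner_neg_left, signDiff_neg_right hz]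
    rw [integral_congr_ae this, div_self pi_ne_zero]
    simp
  obtain ⟨e, f, he, hf, hef, hue, hve⟩ := exists_bisector_basis (α := θ / 2) (by linarith)
    (by linarith) hu hv (by rw [huv]; congr 1; ring)
  simp_rw [hue, hve]
  rw [show θ / π = 2 * (θ / 2) / π by ring, ← integral_planeDiff (by linarith) (by linarith),
    ← integral_comp_inner_pair he hf hef (measurable_planeDiff _)]
  rfl

/-- Two sign disagreements at the same angle are nearly uncorrelated if their directions are nearly
orthogonal, uniformly in the angle. -/
lemma integral_signDiff_mul_signDiff_le {u v u' v' : E} (hu : ‖u‖ = 1) (hv : ‖v‖ = 1)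
    (hu' : ‖u'‖ = 1) (hv' : ‖v'‖ = 1) {θ : ℝ} (h₀ : 0 ≤ θ) (hπ : θ ≤ π) (huv : ⟪u, v⟫ = cos θ)
    (huv' : ⟪u', v'⟫ = cos θ) :
    ∫ z, signDiff ⟪u, z⟫ ⟪v, z⟫ * signDiff ⟪u', z⟫ ⟪v', z⟫ ∂(stdGaussian E) ≤
      (θ / π) ^ 2 + 4 * ((|⟪u, u'⟫| + |⟪v, u'⟫|) + (|⟪u, v'⟫| + |⟪v, v'⟫|)) := by
  have hI := integral_signDiff_inner hu hv h₀ hπ huv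
  have hI' := integral_signDiff_inner hu' hv' h₀ hπ huv'
  have hpp := pi_pos
  have hpos : 0 ≤ 4 * ((|⟪u, u'⟫| + |⟪v, u'⟫|) + (|⟪u, v'⟫| + |⟪v, v'⟫|)) := by positivity
  rcases h₀.eq_or_lt with rfl | h₀
  · obtain rfl := (inner_eq_one_iff_of_norm_eq_one hu hv).1 (huv.trans cos_zero)
    simp only [signDiff_self, zero_mul, integral_zero]
    positivity
  have is : ∀ u v : E, Integrable (fun z => signDiff ⟪u, z⟫ ⟪v, z⟫) (stdGaussian E) :=
    fun u v => integrable_of_mem_Icc (by fun_prop) (fun z => signDiff_nonneg _ _)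
      fun z => signDiff_le_one _ _
  have is2 : Integrable (fun z => signDiff ⟪u, z⟫ ⟪v, z⟫ * signDiff ⟪u', z⟫ ⟪v', z⟫)
      (stdGaussian E) := integrable_of_mem_Icc (by fun_prop)
      (fun z => mul_nonneg (signDiff_nonneg _ _) (signDiff_nonneg _ _))
      fun z => mul_le_one₀ (signDiff_le_one _ _) (signDiff_nonneg _ _) (signDiff_le_one _ _)
  rcases hπ.eq_or_lt with rfl | hπ
  · refine (integral_mono is2 (is u v) fun z =>
      mul_le_of_le_one_right (signDiff_nonneg _ _) (signDiff_le_one _ _)).trans ?_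
    rw [hI, div_self pi_ne_zero]
    linarith
  obtain ⟨e, f, he, hf, hef, hue, hve⟩ := exists_bisector_basis (α := θ / 2) (by linarith)
    (by linarith) hu hv (by rw [huv]; congr 1; ring)
  have hX : ∀ z, signDiff ⟪u, z⟫ ⟪v, z⟫ = planeDiff (θ / 2) (⟪e, z⟫, ⟪f, z⟫) := fun z => by
    rw [hue, hve]; rfl
  have hs : 0 < sin (θ / 2) := sin_pos_of_pos_of_lt_pi (by linarith) (by linarith)
  have hc : 0 < cos (θ / 2) := cos_pos_of_mem_Ioo ⟨by linarith, by linarith⟩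
  have hpd := integral_planeDiff (α := θ / 2) (by linarith) (by linarith)
  rw [show 2 * (θ / 2) / π = θ / π by ring] at hpd
  have hS : ∀ m, 0 ≤ m → m ≤ sin (θ / 2) → m ≤ cos (θ / 2) → ∀ w : E,
      m * (|⟪e, w⟫| + |⟪f, w⟫|) ≤ |⟪u, w⟫| + |⟪v, w⟫| := fun m hm0 hms hmc w => by
    have k₁ : cos (θ / 2) * |⟪e, w⟫| ≤ (|⟪u, w⟫| + |⟪v, w⟫|) / 2 := by
      rw [show cos (θ / 2) * |⟪e, w⟫| = |cos (θ / 2) * ⟪e, w⟫| by rw [abs_mul, abs_of_pos hc],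
        show cos (θ / 2) * ⟪e, w⟫ = (⟪u, w⟫ + ⟪v, w⟫) / 2 by rw [hue, hve]; ring,
        abs_div, abs_two]
      gcongr
      exact abs_add_le _ _
    have k₂ : sin (θ / 2) * |⟪f, w⟫| ≤ (|⟪u, w⟫| + |⟪v, w⟫|) / 2 := by
      rw [show sin (θ / 2) * |⟪f, w⟫| = |sin (θ / 2) * ⟪f, w⟫| by rw [abs_mul, abs_of_pos hs],
        show sin (θ / 2) * ⟪f, w⟫ = (⟪u, w⟫ - ⟪v, w⟫) / 2 by rw [hue, hve]; ring,
        abs_div, abs_two]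
      gcongr
      exact abs_sub _ _
    linarith [mul_le_mul_of_nonneg_right hmc (abs_nonneg ⟪e, w⟫),
      mul_le_mul_of_nonneg_right hms (abs_nonneg ⟪f, w⟫)]
  have hPi : Integrable (planeDiff (θ / 2)) ((gaussianReal 0 1).prod (gaussianReal 0 1)) :=
    integrable_of_mem_Icc (by fun_prop) (fun z => signDiff_nonneg _ _) fun z => signDiff_le_one _ _
  have hPR := integral_planeDiff_mul_planeRadius (θ / 2)
  have hRle := integral_planeRadius_le
  have hp0 : 0 ≤ θ / π := by positivity
  have hp1 : θ / π ≤ 1 := by rw [div_le_one hpp]; exact hπ.le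
  rcases le_total θ (π / 2) with hle | hge
  · have hms : θ / π ≤ sin (θ / 2) := by
      have := mul_le_sin (x := θ / 2) (by linarith) (by linarith)
      calc θ / π = 2 / π * (θ / 2) := by ring
        _ ≤ _ := this
    have hsc : sin (θ / 2) ≤ cos (θ / 2) := by
      rw [← sin_pi_div_two_sub]
      exact sin_le_sin_of_le_of_le_pi_div_two (by linarith) (by linarith) (by linarith)
    have key := abs_integral_mul_signDiff_sub_le he hf hef hu' hv'
      (measurable_planeDiff (θ / 2)) (fun z => signDiff_nonneg _ _) (fun z => signDiff_le_one _ _)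
      (by rw [hPR, mul_comm]; exact mul_le_mul_of_nonneg_right hRle (by rw [hpd]; exact hp0))
    simp_rw [← hX] at key
    rw [hpd, hI', abs_le] at key
    have a₁ := hS _ hp0 hms (hms.trans hsc) u'
    have a₂ := hS _ hp0 hms (hms.trans hsc) v'
    linarith [key.2]
  · have hmc : 1 - θ / π ≤ cos (θ / 2) := by
      rw [← sin_pi_div_two_sub]
      have := mul_le_sin (x := π / 2 - θ / 2) (by linarith) (by linarith)
      calc 1 - θ / π = 2 / π * (π / 2 - θ / 2) := by field_simp
        _ ≤ _ := this
    have hcs : cos (θ / 2) ≤ sin (θ / 2) := by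
      rw [← sin_pi_div_two_sub]
      exact sin_le_sin_of_le_of_le_pi_div_two (by linarith) (by linarith) (by linarith)
    have hq0 : 0 ≤ 1 - θ / π := by linarith
    have hq : ∫ x, (1 - planeDiff (θ / 2) x) ∂((gaussianReal 0 1).prod (gaussianReal 0 1)) =
        1 - θ / π := by
      rw [integral_sub (integrable_const _) hPi, hpd]; simp
    have hPRi : Integrable (fun x => planeDiff (θ / 2) x * planeRadius x)
        ((gaussianReal 0 1).prod (gaussianReal 0 1)) :=
      integrable_planeRadius.mono' (by fun_prop) (ae_of_all _ fun x => by
        have h₀ : 0 ≤ planeDiff (θ / 2) x := signDiff_nonneg _ _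
        rw [Real.norm_of_nonneg (mul_nonneg h₀ (planeRadius_nonneg x))]
        exact mul_le_of_le_one_left (planeRadius_nonneg x) (signDiff_le_one _ _))
    have key := abs_integral_mul_signDiff_sub_le he hf hef hu' hv'
      (h := fun x => 1 - planeDiff (θ / 2) x) (by fun_prop)
      (fun z => sub_nonneg.2 (signDiff_le_one _ _))
      (fun z => sub_le_self _ (signDiff_nonneg _ _))
      (by
        simp_rw [sub_mul, one_mul]
        rw [integral_sub integrable_planeRadius hPRi, hPR, hq, hpd]
        linarith [mul_le_mul_of_nonneg_right hRle hq0])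
    simp_rw [← hX, sub_mul, one_mul] at key
    rw [hq, integral_sub (is _ _) is2, hI', abs_le] at key
    have a₁ := hS _ hq0 (hmc.trans hcs) hmc u'
    have a₂ := hS _ hq0 (hmc.trans hcs) hmc v'
    linarith [key.1]

end

end

lemma measurePreserving_neg_radMeasure :
    MeasurePreserving (fun t : ℝ => -t) radMeasure radMeasure := by
  refine ⟨measurable_neg, ?_⟩
  rw [radMeasure, Measure.map_smul, Measure.map_add _ _ (by fun_prop),
    Measure.map_dirac' (by fun_prop), Measure.map_dirac' (by fun_prop), neg_neg, add_comm]

lemma ae_abs_eq_one_radMeasure : ∀ᵐ t ∂radMeasure, |t| = 1 := by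
  have hs : MeasurableSet {t : ℝ | ¬|t| = 1} :=
    (measurableSet_eq_fun (by fun_prop) (by fun_prop)).compl
  rw [ae_iff, radMeasure, Measure.smul_apply, Measure.add_apply, Measure.dirac_apply' _ hs,
    Measure.dirac_apply' _ hs]
  simp

lemma ae_abs_eq_one_radPi (d : ℕ) : ∀ᵐ D ∂radPi d, ∀ l, |D l| = 1 := by
  rw [ae_all_iff]
  intro l
  exact (measurePreserving_eval (fun _ : Fin d => radMeasure) l).quasiMeasurePreserving.ae
    ae_abs_eq_one_radMeasure

lemma measurePreserving_flip_radPi {d : ℕ} (m : Fin d) :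
    MeasurePreserving (fun (D : Fin d → ℝ) l => if l = m then -D l else D l)
      (radPi d) (radPi d) := by
  refine measurePreserving_pi (fun _ => radMeasure) (fun _ => radMeasure)
    (f := fun l t => if l = m then -t else t) fun l => ?_
  by_cases h : l = m
  · simpa [h] using measurePreserving_neg_radMeasure
  · simp only [h, if_false]
    exact MeasurePreserving.id radMeasure

/-- A mixed fourth moment of Rademacher signs vanishes if one index occurs only once. -/
lemma integral_radPi_four_eq_zero {d : ℕ} {m a b c : Fin d} (ha : a ≠ m) (hb : b ≠ m)
    (hc : c ≠ m) : ∫ D, D m * D a * (D b * D c) ∂radPi d = 0 := by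
  have hT := measurePreserving_flip_radPi m
  have h : ∫ D, D m * D a * (D b * D c) ∂radPi d = ∫ D, -(D m * D a * (D b * D c)) ∂radPi d := by
    conv_lhs => rw [← hT.map_eq]
    rw [integral_map hT.measurable.aemeasurable
      (Measurable.aestronglyMeasurable (by fun_prop))]
    simp [ha, hb, hc]
  rw [integral_neg] at h
  linarith

lemma integrable_radPi_four {d : ℕ} (m a b c : Fin d) :
    Integrable (fun D : Fin d → ℝ => D m * D a * (D b * D c)) (radPi d) := by
  refine Integrable.of_bound (by fun_prop) 1 ?_
  filter_upwards [ae_abs_eq_one_radPi d] with D hD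
  simp [hD]

lemma abs_integral_radPi_four_le {d : ℕ} (m a b c : Fin d) :
    |∫ D, D m * D a * (D b * D c) ∂radPi d| ≤ 1 := by
  have h := norm_integral_le_of_norm_le_const (μ := radPi d)
    (f := fun D : Fin d → ℝ => D m * D a * (D b * D c)) (C := 1) (by
      filter_upwards [ae_abs_eq_one_radPi d] with D hD
      simp [hD])
  simpa using h

/-- Second moment of a bilinear Rademacher form along a derangement-like pair of permutations. -/
lemma integral_sq_radPi_form_le {d : ℕ} (α β : Equiv.Perm (Fin d)) (h : ∀ l, α l ≠ β l)
    (c : Fin d → ℝ) :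
    ∫ D, (∑ l, D (α l) * D (β l) * c l) ^ 2 ∂radPi d ≤ 2 * ∑ l, c l ^ 2 := by
  have hexp : ∀ D : Fin d → ℝ, (∑ l, D (α l) * D (β l) * c l) ^ 2 =
      ∑ l, ∑ n, (D (α l) * D (β l) * (D (α n) * D (β n))) * (c l * c n) := fun D => by
    rw [sq, Finset.sum_mul_sum]
    exact Finset.sum_congr rfl fun l _ => Finset.sum_congr rfl fun n _ => by ring
  simp_rw [hexp]
  rw [integral_finsetSum _ fun l _ => integrable_finsetSum _ fun n _ =>
    (integrable_radPi_four _ _ _ _).mul_const _]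
  have hle : ∀ l n, (∫ D, D (α l) * D (β l) * (D (α n) * D (β n)) ∂radPi d) * (c l * c n) ≤
      (if n = l then c l ^ 2 else 0) +
        if n = β.symm (α l) then (c l ^ 2 + c (β.symm (α l)) ^ 2) / 2 else 0 := fun l n => by
    have hb : (∫ D, D (α l) * D (β l) * (D (α n) * D (β n)) ∂radPi d) * (c l * c n) ≤
        (c l ^ 2 + c n ^ 2) / 2 := by
      refine (le_abs_self _).trans ?_
      rw [abs_mul]
      refine (mul_le_of_le_one_left (abs_nonneg _) (abs_integral_radPi_four_le _ _ _ _)).trans ?_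
      rw [abs_le]
      constructor <;> nlinarith [sq_nonneg (c l + c n), sq_nonneg (c l - c n)]
    by_cases h₁ : n = l
    · subst h₁
      rw [if_pos rfl]
      refine hb.trans ?_
      have : (0 : ℝ) ≤ if n = β.symm (α n) then (c n ^ 2 + c (β.symm (α n)) ^ 2) / 2 else 0 := by
        split_ifs <;> positivity
      linarith
    by_cases h₂ : n = β.symm (α l)
    · rw [if_neg h₁, if_pos h₂, zero_add]
      rwa [h₂] at hb ⊢
    rw [if_neg h₁, if_neg h₂, integral_radPi_four_eq_zero (h l).symm
      (fun e => h₁ (α.injective e)) (fun e => h₂ (by rw [← e, Equiv.symm_apply_apply]))]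
    simp
  calc _ = ∑ l, ∑ n, (∫ D, D (α l) * D (β l) * (D (α n) * D (β n)) ∂radPi d) * (c l * c n) := by
        refine Finset.sum_congr rfl fun l _ => ?_
        rw [integral_finsetSum _ fun n _ => (integrable_radPi_four _ _ _ _).mul_const _]
        exact Finset.sum_congr rfl fun n _ => integral_mul_const _ _
    _ ≤ ∑ l, ∑ n, ((if n = l then c l ^ 2 else 0) +
        if n = β.symm (α l) then (c l ^ 2 + c (β.symm (α l)) ^ 2) / 2 else 0) :=
      Finset.sum_le_sum fun l _ => Finset.sum_le_sum fun n _ => hle l n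
    _ = ∑ l, (c l ^ 2 + (c l ^ 2 + c ((α.trans β.symm) l) ^ 2) / 2) := by
      simp [Finset.sum_add_distrib]
    _ = 2 * ∑ l, c l ^ 2 := by
      rw [Finset.sum_add_distrib, ← Finset.sum_div, Finset.sum_add_distrib,
        Equiv.sum_comp (α.trans β.symm) fun l => c l ^ 2]
      ring

lemma integrable_radPi_form {d : ℕ} (α β : Equiv.Perm (Fin d)) (a b : Fin d → ℝ) :
    Integrable (fun D : Fin d → ℝ =>
      |∑ l, (D (α l) * a (α l)) * (D (β l) * b (β l))|) (radPi d) := by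
  refine Integrable.of_bound (by fun_prop) (∑ l, |a (α l)| * |b (β l)|) ?_
  filter_upwards [ae_abs_eq_one_radPi d] with D hD
  rw [norm_abs_eq_norm]
  refine (norm_sum_le _ _).trans_eq ?_
  simp [hD]

/-- Two shifted copies of randomly signed, well-spread unit vectors are nearly orthogonal. -/
lemma integral_abs_radPi_form_le {d : ℕ} (α β : Equiv.Perm (Fin d)) (h : ∀ l, α l ≠ β l)
    {a b : Fin d → ℝ} {ρ : ℝ} (hρ : 0 < ρ) (ha : ∀ l, |a l| ≤ ρ) (hb : ∑ l, b l ^ 2 = 1) :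
    ∫ D, |∑ l, (D (α l) * a (α l)) * (D (β l) * b (β l))| ∂radPi d ≤ 3 / 2 * ρ := by
  have hform : ∀ D : Fin d → ℝ, ∑ l, (D (α l) * a (α l)) * (D (β l) * b (β l)) =
      ∑ l, D (α l) * D (β l) * (a (α l) * b (β l)) := fun D =>
    Finset.sum_congr rfl fun l _ => by ring
  have hinteg := integrable_radPi_form α β a b
  have hc : ∑ l, (a (α l) * b (β l)) ^ 2 ≤ ρ ^ 2 := by
    calc _ ≤ ∑ l, ρ ^ 2 * b (β l) ^ 2 := Finset.sum_le_sum fun l _ => by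
          rw [mul_pow]
          exact mul_le_mul_of_nonneg_right (sq_le_sq' (abs_le.1 (ha _)).1 (abs_le.1 (ha _)).2)
            (sq_nonneg _)
      _ = ρ ^ 2 := by
        rw [← Finset.mul_sum, Equiv.sum_comp β fun l => b l ^ 2, hb, mul_one]
  have hsq := integral_sq_radPi_form_le α β h fun l => a (α l) * b (β l)
  simp_rw [hform] at hinteg ⊢
  have hinteg_sq : Integrable (fun D : Fin d → ℝ =>
      (∑ l, D (α l) * D (β l) * (a (α l) * b (β l))) ^ 2) (radPi d) := by
    refine Integrable.of_bound (by fun_prop) ((∑ l, |a (α l)| * |b (β l)|) ^ 2) ?_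
    filter_upwards [ae_abs_eq_one_radPi d] with D hD
    rw [norm_pow]
    gcongr
    refine (norm_sum_le _ _).trans_eq ?_
    simp [hD]
  calc _ ≤ ∫ D, ((∑ l, D (α l) * D (β l) * (a (α l) * b (β l))) ^ 2 / ρ + ρ) / 2 ∂radPi d := by
        refine integral_mono hinteg (((hinteg_sq.div_const _).add (integrable_const _)).div_const _)
          fun D => ?_
        set s := ∑ l, D (α l) * D (β l) * (a (α l) * b (β l))
        have : 0 ≤ (|s| - ρ) ^ 2 / ρ := by positivity
        have e : (|s| - ρ) ^ 2 / ρ = s ^ 2 / ρ + ρ - 2 * |s| := by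
          rw [← sq_abs s]; field_simp; ring
        simp only
        linarith
    _ = ((∫ D, (∑ l, D (α l) * D (β l) * (a (α l) * b (β l))) ^ 2 ∂radPi d) / ρ + ρ) / 2 := by
        rw [integral_div, integral_add (hinteg_sq.div_const _) (integrable_const _), integral_div]
        simp
    _ ≤ (2 * ρ ^ 2 / ρ + ρ) / 2 := by
        gcongr
        linarith
    _ = 3 / 2 * ρ := by field_simp; ring

lemma variance_average_le {Ω : Type*} [MeasurableSpace Ω] {μ : Measure Ω} [IsProbabilityMeasure μ]
    {k : ℕ} (hk : k ≠ 0) {X : Fin k → Ω → ℝ} (hX : ∀ i, Measurable (X i)) (h₀ : ∀ i ω, 0 ≤ X i ω)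
    (h₁ : ∀ i ω, X i ω ≤ 1) (hXX : ∀ i ω, X i ω * X i ω = X i ω) {p δ : ℝ} (hδ : 0 ≤ δ)
    (hp : ∀ i, ∫ ω, X i ω ∂μ = p)
    (hij : ∀ i j, i ≠ j → ∫ ω, X i ω * X j ω ∂μ ≤ p ^ 2 + δ) :
    variance (fun ω => 1 / (k : ℝ) * ∑ i, X i ω) μ ≤ 1 / (k : ℝ) * p * (1 - p) + δ := by
  have hi : ∀ i, Integrable (X i) μ := fun i => integrable_of_mem_Icc (hX i) (h₀ i) (h₁ i)
  have hii : ∀ i j, Integrable (fun ω => X i ω * X j ω) μ := fun i j =>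
    integrable_of_mem_Icc ((hX i).mul (hX j)) (fun ω => mul_nonneg (h₀ i ω) (h₀ j ω))
      fun ω => mul_le_one₀ (h₁ i ω) (h₀ j ω) (h₁ j ω)
  have hk' : (0 : ℝ) < k := by positivity
  have hm : MemLp (fun ω => ∑ i, X i ω) 2 μ :=
    memLp_finsetSum _ fun i _ => MemLp.of_bound (hX i).aestronglyMeasurable 1
      (ae_of_all _ fun ω => by rw [Real.norm_of_nonneg (h₀ i ω)]; exact h₁ i ω)
  rw [variance_const_mul, variance_eq_sub hm]
  have e₁ : μ[fun ω => ∑ i, X i ω] = k * p := by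
    rw [integral_finsetSum _ fun i _ => hi i]
    simp [hp]
  have e₂ : μ[(fun ω => ∑ i, X i ω) ^ 2] ≤ k * p + k * (k - 1) * (p ^ 2 + δ) := by
    calc μ[(fun ω => ∑ i, X i ω) ^ 2] = ∑ i, ∑ j, ∫ ω, X i ω * X j ω ∂μ := by
          simp only [Pi.pow_apply, sq, Finset.sum_mul_sum]
          rw [integral_finsetSum _ fun i _ => integrable_finsetSum _ fun j _ => hii i j]
          exact Finset.sum_congr rfl fun i _ => integral_finsetSum _ fun j _ => hii i j
      _ ≤ ∑ i : Fin k, ∑ j : Fin k, ((p ^ 2 + δ) + if i = j then p - (p ^ 2 + δ) else 0) := by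
          refine Finset.sum_le_sum fun i _ => Finset.sum_le_sum fun j _ => ?_
          split_ifs with h
          · subst h
            simp_rw [hXX, hp]
            linarith
          · rw [add_zero]
            exact hij i j h
      _ = k * p + k * (k - 1) * (p ^ 2 + δ) := by
          simp [Finset.sum_add_distrib]
          ring
  rw [e₁]
  calc (1 / (k : ℝ)) ^ 2 * (μ[(fun ω => ∑ i, X i ω) ^ 2] - (k * p) ^ 2)
      ≤ (1 / (k : ℝ)) ^ 2 * (k * p + k * (k - 1) * (p ^ 2 + δ) - (k * p) ^ 2) := by gcongr
    _ = 1 / (k : ℝ) * p * (1 - p) + δ - δ / k := by field_simp; ring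
    _ ≤ _ := by linarith [div_nonneg hδ hk'.le]

section

open scoped RealInnerProductSpace

/-- Row `i` of `circ(r) · diag(D) · x`, seen as the linear form `r ↦ ⟪signedRow i D x, r⟫`. -/
def signedRow {d : ℕ} (i : Fin d) (D x : Fin d → ℝ) : EuclideanSpace ℝ (Fin d) :=
  WithLp.toLp 2 fun l => D (i - l) * x (i - l)

lemma integral_gaussPi_comp_toLp {d : ℕ} {g : EuclideanSpace ℝ (Fin d) → ℝ} (hg : Measurable g) :
    ∫ r, g (WithLp.toLp 2 r) ∂gaussPi d = ∫ z, g z ∂stdGaussian (EuclideanSpace ℝ (Fin d)) := by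
  rw [← map_pi_eq_stdGaussian, integral_map (by fun_prop) hg.aestronglyMeasurable]
  rfl

lemma inner_signedRow {d : ℕ} (i j : Fin d) (D x y : Fin d → ℝ) :
    ⟪signedRow i D x, signedRow j D y⟫ =
      ∑ l, (D (i - l) * x (i - l)) * (D (j - l) * y (j - l)) := by
  simp [signedRow, PiLp.inner_apply, mul_comm]

lemma inner_signedRow_toLp {d : ℕ} [NeZero d] (i : Fin d) (D x r : Fin d → ℝ) :
    ⟪signedRow i D x, WithLp.toLp 2 r⟫ = ∑ j, r (i - j) * (D j * x j) := by
  rw [← Equiv.sum_comp (Equiv.subLeft i)]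
  simp [signedRow, PiLp.inner_apply]

lemma inner_signedRow_self {d : ℕ} [NeZero d] (i : Fin d) {D : Fin d → ℝ} (hD : ∀ l, |D l| = 1)
    (x y : Fin d → ℝ) : ⟪signedRow i D x, signedRow i D y⟫ = dotp x y := by
  rw [inner_signedRow, dotp, ← Equiv.sum_comp (Equiv.subLeft i) fun l => x l * y l]
  refine Finset.sum_congr rfl fun l _ => ?_
  have h : D (i - l) * D (i - l) = 1 := by rw [← abs_mul_abs_self, hD, one_mul]
  simp only [Equiv.subLeft_apply]
  linear_combination (x (i - l) * y (i - l)) * h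

lemma norm_signedRow {d : ℕ} [NeZero d] (i : Fin d) {D : Fin d → ℝ} (hD : ∀ l, |D l| = 1)
    {x : Fin d → ℝ} (hx : ∑ l, x l ^ 2 = 1) : ‖signedRow i D x‖ = 1 := by
  rw [← pow_eq_one_iff_of_nonneg (norm_nonneg _) two_ne_zero, ← real_inner_self_eq_norm_sq,
    inner_signedRow_self i hD, ← hx, dotp]
  exact Finset.sum_congr rfl fun l _ => (sq _).symm

/-- The `i`-th bit disagreement of the two embeddings. -/
def bitDiff {d : ℕ} (x y : Fin d → ℝ) (i : Fin d) (ω : (Fin d → ℝ) × (Fin d → ℝ)) : ℝ :=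
  signDiff (∑ j, ω.1 (i - j) * (ω.2 j * x j)) (∑ j, ω.1 (i - j) * (ω.2 j * y j))

lemma measurable_bitDiff {d : ℕ} (x y : Fin d → ℝ) (i : Fin d) : Measurable (bitDiff x y i) := by
  unfold bitDiff
  fun_prop

lemma integral_bitDiff {d : ℕ} [NeZero d] {x y : Fin d → ℝ} (hx : ∑ l, x l ^ 2 = 1)
    (hy : ∑ l, y l ^ 2 = 1) {θ : ℝ} (h₀ : 0 ≤ θ) (hπ : θ ≤ π) (hxy : dotp x y = cos θ) (i : Fin d) :
    ∫ ω, bitDiff x y i ω ∂(gaussPi d).prod (radPi d) = θ / π := by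
  have hinteg : Integrable (bitDiff x y i) ((gaussPi d).prod (radPi d)) :=
    integrable_of_mem_Icc (measurable_bitDiff x y i) (fun ω => signDiff_nonneg _ _)
      fun ω => signDiff_le_one _ _
  rw [integral_prod_symm _ hinteg]
  have h : ∀ᵐ D ∂radPi d, ∫ r, bitDiff x y i (r, D) ∂gaussPi d = θ / π := by
    filter_upwards [ae_abs_eq_one_radPi d] with D hD
    simp only [bitDiff, ← inner_signedRow_toLp]
    rw [integral_gaussPi_comp_toLp (g := fun z => signDiff ⟪signedRow i D x, z⟫
      ⟪signedRow i D y, z⟫) (by fun_prop)]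
    exact integral_signDiff_inner (norm_signedRow i hD hx) (norm_signedRow i hD hy) h₀ hπ
      (by rw [inner_signedRow_self i hD, hxy])
  rw [integral_congr_ae h]
  simp

lemma integral_bitDiff_mul_bitDiff_le {d : ℕ} [NeZero d] {x y : Fin d → ℝ}
    (hx : ∑ l, x l ^ 2 = 1) (hy : ∑ l, y l ^ 2 = 1) {ρ : ℝ} (hρ : 0 < ρ) (hxρ : ∀ l, |x l| ≤ ρ)
    (hyρ : ∀ l, |y l| ≤ ρ) {θ : ℝ} (h₀ : 0 ≤ θ) (hπ : θ ≤ π) (hxy : dotp x y = cos θ)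
    {i j : Fin d} (hij : i ≠ j) :
    ∫ ω, bitDiff x y i ω * bitDiff x y j ω ∂(gaussPi d).prod (radPi d) ≤
      (θ / π) ^ 2 + 24 * ρ := by
  have hinteg : Integrable (fun ω => bitDiff x y i ω * bitDiff x y j ω)
      ((gaussPi d).prod (radPi d)) :=
    integrable_of_mem_Icc ((measurable_bitDiff x y i).mul (measurable_bitDiff x y j))
      (fun ω => mul_nonneg (signDiff_nonneg _ _) (signDiff_nonneg _ _))
      fun ω => mul_le_one₀ (signDiff_le_one _ _) (signDiff_nonneg _ _) (signDiff_le_one _ _)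
  have hform : ∀ a b : Fin d → ℝ,
      Integrable (fun D => |⟪signedRow i D a, signedRow j D b⟫|) (radPi d) := fun a b => by
    simp_rw [inner_signedRow]
    exact integrable_radPi_form (Equiv.subLeft i) (Equiv.subLeft j) a b
  have hle : ∀ a b : Fin d → ℝ, (∀ l, |a l| ≤ ρ) → ∑ l, b l ^ 2 = 1 →
      ∫ D, |⟪signedRow i D a, signedRow j D b⟫| ∂radPi d ≤ 3 / 2 * ρ := fun a b ha hb => by
    simp_rw [inner_signedRow]
    exact integral_abs_radPi_form_le (Equiv.subLeft i) (Equiv.subLeft j)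
      (fun l h => hij (sub_left_injective h)) hρ ha hb
  rw [integral_prod_symm _ hinteg]
  have h : ∀ᵐ D ∂radPi d, ∫ r, bitDiff x y i (r, D) * bitDiff x y j (r, D) ∂gaussPi d ≤
      (θ / π) ^ 2 + 4 * ((|⟪signedRow i D x, signedRow j D x⟫| +
        |⟪signedRow i D y, signedRow j D x⟫|) + (|⟪signedRow i D x, signedRow j D y⟫| +
        |⟪signedRow i D y, signedRow j D y⟫|)) := by
    filter_upwards [ae_abs_eq_one_radPi d] with D hD
    simp only [bitDiff, ← inner_signedRow_toLp]
    rw [integral_gaussPi_comp_toLp (g := fun z => signDiff ⟪signedRow i D x, z⟫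
      ⟪signedRow i D y, z⟫ * signDiff ⟪signedRow j D x, z⟫ ⟪signedRow j D y, z⟫) (by fun_prop)]
    exact integral_signDiff_mul_signDiff_le (norm_signedRow i hD hx) (norm_signedRow i hD hy)
      (norm_signedRow j hD hx) (norm_signedRow j hD hy) h₀ hπ
      (by rw [inner_signedRow_self i hD, hxy]) (by rw [inner_signedRow_self j hD, hxy])
  have hX : Integrable (fun D => |⟪signedRow i D x, signedRow j D x⟫| +
      |⟪signedRow i D y, signedRow j D x⟫|) (radPi d) := (hform x x).add (hform y x)
  have hY : Integrable (fun D => |⟪signedRow i D x, signedRow j D y⟫| +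
      |⟪signedRow i D y, signedRow j D y⟫|) (radPi d) := (hform x y).add (hform y y)
  refine (integral_mono_ae hinteg.integral_prod_right
    ((integrable_const _).add ((hX.add hY).const_mul 4)) h).trans ?_
  have e := integral_add (integrable_const (μ := radPi d) ((θ / π) ^ 2)) ((hX.add hY).const_mul 4)
  simp only [Pi.add_apply] at e ⊢
  rw [e, integral_const_mul, integral_add hX hY, integral_add (hform x x) (hform y x),
    integral_add (hform x y) (hform y y)]
  have := hle x x hxρ hx
  have := hle y x hyρ hx
  have := hle x y hxρ hy
  have := hle y y hyρ hy
  simp only [integral_const, probReal_univ, smul_eq_mul, one_mul]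
  linarith

lemma average_hamming_cbe_eq {d k : ℕ} (hk : k ≤ d) (x y r D : Fin d → ℝ) :
    1 / (2 * (k : ℝ)) * l1norm (cbe hk r D x - cbe hk r D y) =
      1 / (k : ℝ) * ∑ i, bitDiff x y (Fin.castLE hk i) (r, D) := by
  simp only [l1norm, cbe, bitDiff, signDiff, Pi.sub_apply, ← Finset.sum_div]
  ring

lemma variance_cbe_le_of_unit {d k : ℕ} [NeZero d] (hk : k ≤ d) {x y : Fin d → ℝ}
    (hx : ∑ l, x l ^ 2 = 1) (hy : ∑ l, y l ^ 2 = 1) {ρ : ℝ} (hρ : 0 < ρ) (hxρ : ∀ l, |x l| ≤ ρ)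
    (hyρ : ∀ l, |y l| ≤ ρ) {θ : ℝ} (h₀ : 0 ≤ θ) (hπ : θ ≤ π) (hxy : dotp x y = cos θ) :
    variance
      (fun ω : (Fin d → ℝ) × (Fin d → ℝ) =>
        (1 / (2 * (k : ℝ))) * l1norm (cbe hk ω.1 ω.2 x - cbe hk ω.1 ω.2 y))
      ((gaussPi d).prod (radPi d))
      ≤ (1 / (k : ℝ)) * (θ / π) * (1 - θ / π) + 24 * ρ := by
  simp_rw [average_hamming_cbe_eq]
  rcases eq_or_ne k 0 with rfl | hk0
  · simp only [Nat.cast_zero, div_zero, zero_mul, zero_add]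
    exact (variance_zero _).trans_le (by positivity)
  exact variance_average_le hk0 (fun i => measurable_bitDiff x y _)
    (fun i ω => signDiff_nonneg _ _) (fun i ω => signDiff_le_one _ _)
    (fun i ω => signDiff_mul_self _ _) (by positivity)
    (fun i => integral_bitDiff hx hy h₀ hπ hxy _)
    fun i j hij => integral_bitDiff_mul_bitDiff_le hx hy hρ hxρ hyρ h₀ hπ hxy
      fun h => hij (Fin.castLE_injective hk h)

end

lemma sgn_mul_of_pos {c : ℝ} (hc : 0 < c) (t : ℝ) : sgn (c * t) = sgn t := by
  simp [sgn, mul_nonneg_iff_of_pos_left hc]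

lemma cbe_smul {d k : ℕ} (hk : k ≤ d) (r D x : Fin d → ℝ) {c : ℝ} (hc : 0 < c) :
    cbe hk r D (c • x) = cbe hk r D x := by
  funext i
  rw [cbe, cbe, ← sgn_mul_of_pos hc (∑ j, r (Fin.castLE hk i - j) * (D j * x j)),
    Finset.mul_sum]
  congr 1
  exact Finset.sum_congr rfl fun j _ => by simp only [Pi.smul_apply, smul_eq_mul]; ring

lemma l2norm_pos {ι : Type*} [Fintype ι] {x : ι → ℝ} (hx : x ≠ 0) : 0 < l2norm x := by
  obtain ⟨i, hi⟩ := Function.ne_iff.1 hx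
  refine Real.sqrt_pos.2 (Finset.sum_pos' (fun j _ => sq_nonneg _) ⟨i, Finset.mem_univ i, ?_⟩)
  have : x i ≠ 0 := hi
  positivity

lemma sum_sq_inv_l2norm_smul {ι : Type*} [Fintype ι] {x : ι → ℝ} (hx : x ≠ 0) :
    ∑ i, ((l2norm x)⁻¹ • x) i ^ 2 = 1 := by
  have h : l2norm x ^ 2 = ∑ i, x i ^ 2 := Real.sq_sqrt (Finset.sum_nonneg fun i _ => sq_nonneg _)
  have h' := l2norm_pos hx
  simp only [Pi.smul_apply, smul_eq_mul, mul_pow, ← Finset.mul_sum, ← h]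
  field_simp

lemma abs_inv_l2norm_smul_le {ι : Type*} [Fintype ι] {x : ι → ℝ} (hx : x ≠ 0) {ρ : ℝ}
    (hρ : linf x / l2norm x ≤ ρ) (i : ι) : |((l2norm x)⁻¹ • x) i| ≤ ρ := by
  have h := l2norm_pos hx
  have hi : |x i| ≤ linf x := le_ciSup (f := fun i => |x i|) (Set.finite_range _).bddAbove i
  rw [Pi.smul_apply, smul_eq_mul, abs_mul, abs_of_pos (inv_pos.2 h), ← div_eq_inv_mul]
  exact (div_le_div_of_nonneg_right hi h.le).trans hρ

lemma dotp_inv_l2norm_smul {ι : Type*} [Fintype ι] (x y : ι → ℝ) :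
    dotp ((l2norm x)⁻¹ • x) ((l2norm y)⁻¹ • y) = dotp x y / (l2norm x * l2norm y) := by
  simp only [dotp, Pi.smul_apply, smul_eq_mul, Finset.sum_div]
  refine Finset.sum_congr rfl fun i _ => ?_
  rw [div_eq_mul_inv, mul_inv]
  ring

lemma abs_dotp_le_one {ι : Type*} [Fintype ι] {x y : ι → ℝ} (hx : ∑ i, x i ^ 2 = 1)
    (hy : ∑ i, y i ^ 2 = 1) : |dotp x y| ≤ 1 := by
  have h := Finset.sum_mul_sq_le_sq_mul_sq Finset.univ x y
  rw [hx, hy, mul_one] at h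
  exact (sq_le_one_iff_abs_le_one _).1 h

/-- **Variance bound for randomized CBE.** For `x, y` with `ℓ∞/ℓ₂` ratio at most `ρ < 1` and
angle `θ`, the variance (over the Gaussian `r` and Rademacher signs `D`) of the averaged Hamming
distance of the `k`-bit circulant binary embeddings is at most
`(1/k)(θ/π)(1 − θ/π) + 32ρ`. -/
theorem stmt6 {d k : ℕ} (hk : k ≤ d) (x y : Fin d → ℝ) (hx : x ≠ 0) (hy : y ≠ 0)
    (ρ : ℝ) (hρ1 : ρ < 1)
    (hρ : max (linf x / l2norm x) (linf y / l2norm y) ≤ ρ)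
    (θ : ℝ) (hθ : θ = angle' x y) :
    variance
      (fun ω : (Fin d → ℝ) × (Fin d → ℝ) =>
        (1 / (2 * (k : ℝ))) * l1norm (cbe hk ω.1 ω.2 x - cbe hk ω.1 ω.2 y))
      ((gaussPi d).prod (radPi d))
      ≤ (1 / (k : ℝ)) * (θ / π) * (1 - θ / π) + 32 * ρ := by
  have hx' := sum_sq_inv_l2norm_smul hx
  have hy' := sum_sq_inv_l2norm_smul hy
  have hxρ := abs_inv_l2norm_smul_le hx ((le_max_left _ _).trans hρ)
  have hyρ := abs_inv_l2norm_smul_le hy ((le_max_right _ _).trans hρ)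
  have hdot := abs_le.1 (abs_dotp_le_one hx' hy')
  obtain ⟨m, hm⟩ := Function.ne_iff.1 hx
  have : NeZero d := ⟨m.pos.ne'⟩
  have hρ0 : 0 < ρ := by
    refine lt_of_lt_of_le (abs_pos.2 ?_) (hxρ m)
    exact mul_ne_zero (inv_ne_zero (l2norm_pos hx).ne') hm
  have hcos : dotp ((l2norm x)⁻¹ • x) ((l2norm y)⁻¹ • y) = cos θ := by
    rw [hθ, angle', ← dotp_inv_l2norm_smul, cos_arccos hdot.1 hdot.2]
  have h := variance_cbe_le_of_unit hk hx' hy' hρ0 hxρ hyρ (by rw [hθ]; exact arccos_nonneg _)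
    (by rw [hθ]; exact arccos_le_pi _) hcos
  simp_rw [cbe_smul hk _ _ _ (inv_pos.2 (l2norm_pos hx)),
    cbe_smul hk _ _ _ (inv_pos.2 (l2norm_pos hy))] at h
  linarith

end
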